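/- Let M, N ≥ 2 and let Π ∈ ℝ^{M×N} be a positive coupling matrix with uniform marginals. Let σ₁ ≥ σ₂ be the two largest singular values of Π, let λ₁ = 1/M + 1/N (the largest eigenvalue of H(Π)), and let λ_{M+N−1} denote the second smallest eigenvalue of H(Π) (its eigenvalues listed in descending order with multiplicity). Then (σ₁² − σ₂²)/λ₁ ≤ λ_{M+N−1} ≤ 2(σ₁² − σ₂²)/λ₁. -/

import Mathlib

open Matrix Polynomial

lemma aux_roots {ι : Type*} [Fintype ι] (p : ι → ℝ) :
    (∏ i, (X - C (p i))).roots = Finset.univ.val.map p := by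
  have := Polynomial.roots_multiset_prod_X_sub_C (Finset.univ.val.map p)
  rw [Multiset.map_map] at this
  exact this

lemma aux_ne {ι : Type*} [Fintype ι] (p : ι → ℝ) :
    (∏ i, (X - C (p i))) ≠ 0 := 
  Finset.prod_ne_zero_iff.2 fun i _ => X_sub_C_ne_zero _

lemma aux_charpoly {M N : ℕ} (P : Matrix (Fin M) (Fin N) ℝ) (a b : ℝ) :
    (X - C b) ^ M * (fromBlocks (diagonal fun _ => a) P Pᵀ (diagonal fun _ => b)).charpoly
      = (X - C b) ^ N * ((P * Pᵀ).charpoly.comp ((X - C a) * (X - C b))) := by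
  set d : ℝ[X] := X - C b with hd
  set e : ℝ[X] := X - C a with he
  have h1 : charmatrix (fromBlocks (diagonal fun _ => a) P Pᵀ (diagonal fun _ => b))
      = fromBlocks (e • (1 : Matrix (Fin M) (Fin M) ℝ[X])) (-(P.map C)) (-(Pᵀ.map C))
        (d • (1 : Matrix (Fin N) (Fin N) ℝ[X])) := by
    rw [charmatrix_fromBlocks]
    congr 1
    · ext1 i j
      by_cases h : i = j <;> simp [charmatrix_apply, h, he]
    · ext1 i j
      by_cases h : i = j <;> simp [charmatrix_apply, h, hd]
  have h2 : fromBlocks (e • (1 : Matrix (Fin M) (Fin M) ℝ[X])) (-(P.map C)) (-(Pᵀ.map C))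
        (d • (1 : Matrix (Fin N) (Fin N) ℝ[X])) *
      fromBlocks (d • (1 : Matrix (Fin M) (Fin M) ℝ[X])) 0 (Pᵀ.map C) 1
      = fromBlocks ((e * d) • (1 : Matrix (Fin M) (Fin M) ℝ[X]) - (P * Pᵀ).map C) (-(P.map C)) 0
        (d • (1 : Matrix (Fin N) (Fin N) ℝ[X])) := by
    rw [fromBlocks_multiply]
    congr 1
    · simp [smul_smul, Matrix.map_mul, sub_eq_add_neg, mul_comm]
    · simp
    · simp
    · simp
  have h3 : ((P * Pᵀ).charpoly.comp (e * d))
      = ((e * d) • (1 : Matrix (Fin M) (Fin M) ℝ[X]) - (P * Pᵀ).map C).det := by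
    rw [charpoly, ← coe_compRingHom_apply, RingHom.map_det]
    congr 1
    ext1 i j
    generalize P * Pᵀ = Q
    by_cases h : i = j <;> simp [h]
  have h4 := congrArg det h2
  rw [det_mul, det_fromBlocks_zero₁₂, det_fromBlocks_zero₂₁, ← h1, ← h3] at h4
  simp only [det_smul, det_one, Fintype.card_fin, mul_one] at h4
  rw [charpoly, mul_comm, h4, mul_comm]

lemma aux_sigma {M N : ℕ} (h0M : 0 < M)
    (P : Matrix (Fin M) (Fin N) ℝ)
    (hpos : ∀ i j, 0 < P i j)
    (hrow : P *ᵥ 1 = fun _ => 1 / (M : ℝ))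
    (hcol : Pᵀ *ᵥ 1 = fun _ => 1 / (N : ℝ))
    (σ : Fin M → ℝ) (hσa : Antitone σ) (hσ0 : ∀ i, 0 ≤ σ i)
    (hσchar : (P * Pᵀ).charpoly = ∏ i, (Polynomial.X - Polynomial.C (σ i ^ 2))) :
    σ ⟨0, h0M⟩ ^ 2 = 1 / (M : ℝ) * (1 / (N : ℝ)) := by
  have h1 : (P * Pᵀ) *ᵥ 1 = (1 / (M : ℝ) * (1 / (N : ℝ))) • (1 : Fin M → ℝ) := by
    rw [← mulVec_mulVec, hcol]
    have : (fun _ : Fin N => 1 / (N : ℝ)) = (1 / (N : ℝ)) • (1 : Fin N → ℝ) := by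
      ext i; simp
    rw [this, mulVec_smul, hrow]
    ext i; simp [mul_comm]
  have hnn : ∀ i j, 0 ≤ (P * Pᵀ) i j := fun i j => by
    rw [mul_apply]
    exact Finset.sum_nonneg fun k _ => mul_nonneg (hpos _ _).le (hpos _ _).le
  have hle : ∀ i, σ i ^ 2 ≤ 1 / (M : ℝ) * (1 / (N : ℝ)) := by
    intro i
    have hr : (P * Pᵀ).charpoly.IsRoot (σ i ^ 2) := by
      rw [hσchar, IsRoot.def, eval_prod]
      exact Finset.prod_eq_zero (Finset.mem_univ i) (by simp)
    have he : Module.End.HasEigenvalue (Matrix.toLin' (P * Pᵀ)) (σ i ^ 2) := by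
      rw [Module.End.hasEigenvalue_iff_isRoot_charpoly]
      rwa [Matrix.charpoly_toLin']
    obtain ⟨k, hk⟩ := eigenvalue_mem_ball he
    rw [Metric.mem_closedBall, Real.dist_eq] at hk
    have h2 := (abs_le.1 hk).2
    have h3 := congrFun h1 k
    simp only [mulVec, dotProduct, Pi.one_apply, mul_one, Pi.smul_apply, smul_eq_mul] at h3
    rw [← Finset.add_sum_erase _ _ (Finset.mem_univ k)] at h3
    have h4 : ∑ j ∈ Finset.univ.erase k, ‖(P * Pᵀ) k j‖ = ∑ j ∈ Finset.univ.erase k, (P * Pᵀ) k j :=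
      Finset.sum_congr rfl fun j _ => by rw [Real.norm_of_nonneg (hnn _ _)]
    linarith
  have he : Module.End.HasEigenvalue (Matrix.toLin' (P * Pᵀ)) (1 / (M : ℝ) * (1 / (N : ℝ))) := by
    refine Module.End.hasEigenvalue_of_hasEigenvector (x := 1) ⟨?_, ?_⟩
    · rw [Module.End.mem_eigenspace_iff, toLin'_apply, h1]
    · intro h
      have := congrFun h ⟨0, h0M⟩
      simp at this
  rw [Module.End.hasEigenvalue_iff_isRoot_charpoly] at he
  have he' : (P * Pᵀ).charpoly.IsRoot (1 / (M : ℝ) * (1 / (N : ℝ))) := by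
    rwa [Matrix.charpoly_toLin'] at he
  rw [hσchar, IsRoot.def, eval_prod, Finset.prod_eq_zero_iff] at he'
  obtain ⟨i, -, hi⟩ := he'
  simp only [eval_sub, eval_X, eval_C] at hi
  have h5 : σ i ≤ σ ⟨0, h0M⟩ := hσa (Fin.mk_le_mk.2 (Nat.zero_le _))
  have h6 := pow_le_pow_left₀ (hσ0 i) h5 2
  linarith [hle ⟨0, h0M⟩]

lemma aux_second {M N : ℕ} (h0M : 0 < M) (h1M : 1 < M)
    (h2M : M + N - 2 < M + N) (h3M : M + N - 1 < M + N) (a b : ℝ) (hab : b ≤ a → M ≤ N)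
    (f g : Fin M → ℝ) (hf : Monotone f) (hfa : ∀ i, f i ≤ a) (hfb : ∀ i, f i ≤ b)
    (hg : ∀ i, b ≤ g i)
    (lam : Fin (M + N) → ℝ) (hlama : Antitone lam)
    (h : (X - C b) ^ M * ∏ i, (X - C (lam i)) =
      (X - C b) ^ N * ((∏ i, (X - C (f i))) * ∏ i, (X - C (g i)))) :
    lam ⟨M + N - 2, h2M⟩ = f ⟨1, h1M⟩ := by
  have hr := congrArg roots h
  have hb : ∀ n, (X - C b) ^ n ≠ 0 := fun n => pow_ne_zero _ (X_sub_C_ne_zero _)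
  rw [roots_mul (mul_ne_zero (hb _) (aux_ne _)),
    roots_mul (mul_ne_zero (hb _) (mul_ne_zero (aux_ne _) (aux_ne _))),
    roots_mul (mul_ne_zero (aux_ne _) (aux_ne _)), aux_roots, aux_roots, aux_roots,
    roots_pow, roots_pow, roots_X_sub_C] at hr
  apply le_antisymm
  · by_contra! hlt
    have hc := congrArg (Multiset.countP (fun x => x ≤ f ⟨1, h1M⟩)) hr
    simp only [Multiset.countP_add, Multiset.countP_nsmul, Multiset.countP_map] at hc
    have h1 : (Multiset.filter (fun i => lam i ≤ f ⟨1, h1M⟩)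
        (Finset.univ : Finset (Fin (M+N))).val).card ≤ 1 := by
      change (Finset.univ.filter (fun i => lam i ≤ f ⟨1, h1M⟩)).card ≤ 1
      rw [Finset.card_le_one]
      have key : ∀ i : Fin (M+N), lam i ≤ f ⟨1, h1M⟩ → (i : ℕ) = M + N - 1 := by
        intro i hi
        by_contra hne
        have : lam ⟨M + N - 2, h2M⟩ ≤ lam i := hlama (Fin.mk_le_mk.2 (by omega))
        linarith
      intro i hi j hj
      simp only [Finset.mem_filter, Finset.mem_univ, true_and] at hi hj
      exact Fin.ext ((key i hi).trans (key j hj).symm)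
    have h2 : 2 ≤ (Multiset.filter (fun i => f i ≤ f ⟨1, h1M⟩)
        (Finset.univ : Finset (Fin M)).val).card := by
      change 2 ≤ (Finset.univ.filter (fun i => f i ≤ f ⟨1, h1M⟩)).card
      apply Finset.one_lt_card.2
      refine ⟨⟨0, h0M⟩, ?_, ⟨1, h1M⟩, ?_, by simp⟩
      · simp only [Finset.mem_filter, Finset.mem_univ, true_and]
        exact hf (Fin.mk_le_mk.2 (by omega))
      · simp
    by_cases hbf : b ≤ f ⟨1, h1M⟩
    · have := hab (hbf.trans (hfa _))
      have e : Multiset.countP (fun x => x ≤ f ⟨1, h1M⟩) {b} = 1 := by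
        rw [Multiset.countP_eq_card.2 (by simpa using hbf)]; simp
      rw [e] at hc
      omega
    · have e : Multiset.countP (fun x => x ≤ f ⟨1, h1M⟩) {b} = 0 := by
        rw [Multiset.countP_eq_zero.2 (by simpa using hbf)]
      rw [e] at hc
      omega
  · by_contra! hlt
    have hc := congrArg (Multiset.countP (fun x => x < f ⟨1, h1M⟩)) hr
    simp only [Multiset.countP_add, Multiset.countP_nsmul, Multiset.countP_map] at hc
    have e : Multiset.countP (fun x => x < f ⟨1, h1M⟩) {b} = 0 := by
      rw [Multiset.countP_eq_zero.2 (by simpa using hfb _)]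
    have h1 : 2 ≤ (Multiset.filter (fun i => lam i < f ⟨1, h1M⟩)
        (Finset.univ : Finset (Fin (M+N))).val).card := by
      change 2 ≤ (Finset.univ.filter (fun i => lam i < f ⟨1, h1M⟩)).card
      apply Finset.one_lt_card.2
      refine ⟨⟨M + N - 2, h2M⟩, ?_, ⟨M + N - 1, h3M⟩, ?_, ?_⟩
      · simpa using hlt
      · simp only [Finset.mem_filter, Finset.mem_univ, true_and]
        exact (hlama (Fin.mk_le_mk.2 (by omega))).trans_lt hlt
      · simp only [ne_eq, Fin.mk.injEq]; omega
    have h2 : (Multiset.filter (fun i => f i < f ⟨1, h1M⟩)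
        (Finset.univ : Finset (Fin M)).val).card ≤ 1 := by
      change (Finset.univ.filter (fun i => f i < f ⟨1, h1M⟩)).card ≤ 1
      rw [Finset.card_le_one]
      have key : ∀ i : Fin M, f i < f ⟨1, h1M⟩ → (i : ℕ) = 0 := by
        intro i hi
        by_contra hne
        have : f ⟨1, h1M⟩ ≤ f i := hf (Fin.mk_le_mk.2 (by omega))
        linarith
      intro i hi j hj
      simp only [Finset.mem_filter, Finset.mem_univ, true_and] at hi hj
      exact Fin.ext ((key i hi).trans (key j hj).symm)
    have h3 : (Multiset.filter (fun i => g i < f ⟨1, h1M⟩)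
        (Finset.univ : Finset (Fin M)).val).card = 0 := by
      rw [Multiset.card_eq_zero, Multiset.filter_eq_nil]
      intro i _
      exact not_lt.2 ((hfb _).trans (hg _))
    rw [e] at hc
    omega

/-- Bounds on the second smallest eigenvalue `λ_{M+N-1}` of the H-matrix of a
positive coupling matrix with uniform marginals:
`(σ₁² - σ₂²)/lam1 ≤ λ_{M+N-1} ≤ 2(σ₁² - σ₂²)/lam1` where `lam1 = 1/M + 1/N`. -/
theorem stmt14 (M N : ℕ) (hM : 2 ≤ M) (hN : 2 ≤ N)
    (P : Matrix (Fin M) (Fin N) ℝ)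
    (hpos : ∀ i j, 0 < P i j)
    (hrow : P *ᵥ 1 = fun _ => 1 / (M : ℝ))
    (hcol : Pᵀ *ᵥ 1 = fun _ => 1 / (N : ℝ))
    (σ : Fin M → ℝ) (hσa : Antitone σ) (hσ0 : ∀ i, 0 ≤ σ i)
    (hσchar : (P * Pᵀ).charpoly = ∏ i, (Polynomial.X - Polynomial.C (σ i ^ 2)))
    (lam : Fin (M + N) → ℝ) (hlama : Antitone lam)
    (hlamchar :
      (Matrix.fromBlocks (Matrix.diagonal (P *ᵥ 1)) P Pᵀ
          (Matrix.diagonal (Pᵀ *ᵥ 1))).charpoly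
        = ∏ i, (Polynomial.X - Polynomial.C (lam i))) :
    let σ₁ := σ ⟨0, by omega⟩
    let σ₂ := σ ⟨1, by omega⟩
    let lam1 : ℝ := 1 / (M : ℝ) + 1 / (N : ℝ)
    (σ₁ ^ 2 - σ₂ ^ 2) / lam1 ≤ lam ⟨M + N - 2, by omega⟩ ∧
    lam ⟨M + N - 2, by omega⟩ ≤ 2 * (σ₁ ^ 2 - σ₂ ^ 2) / lam1 := by
  intro σ₁ σ₂ lam1
  have hs1 : σ₁ ^ 2 = 1 / (M : ℝ) * (1 / (N : ℝ)) :=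
    aux_sigma (by omega) P hpos hrow hcol σ hσa hσ0 hσchar
  have hM0 : (0 : ℝ) < M := by exact_mod_cast (by omega : 0 < M)
  have hN0 : (0 : ℝ) < N := by exact_mod_cast (by omega : 0 < N)
  have hba : 1 / (N : ℝ) ≤ 1 / (M : ℝ) → M ≤ N := fun h => by
    exact_mod_cast (one_div_le_one_div hN0 hM0).1 h
  have ha : 0 < 1 / (M : ℝ) := by positivity
  have hb : 0 < 1 / (N : ℝ) := by positivity
  have hch := aux_charpoly P (1 / (M : ℝ)) (1 / (N : ℝ))
  rw [hrow, hcol] at hlamchar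
  rw [hlamchar, hσchar, Polynomial.prod_comp] at hch
  have hl : lam1 = 1 / (M : ℝ) + 1 / (N : ℝ) := rfl
  clear_value lam1
  generalize 1 / (M : ℝ) = a at *
  generalize 1 / (N : ℝ) = b at *
  have hD0 : ∀ i, 0 ≤ (a - b) ^ 2 + 4 * σ i ^ 2 := fun i => by positivity
  have hsq : ∀ i, √((a - b) ^ 2 + 4 * σ i ^ 2) ^ 2 = (a - b) ^ 2 + 4 * σ i ^ 2 :=
    fun i => Real.sq_sqrt (hD0 i)
  have habs : ∀ i, |a - b| ≤ √((a - b) ^ 2 + 4 * σ i ^ 2) := fun i =>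
    Real.abs_le_sqrt (by nlinarith [sq_nonneg (σ i)])
  have hmono : ∀ i j, i ≤ j → √((a - b) ^ 2 + 4 * σ j ^ 2) ≤ √((a - b) ^ 2 + 4 * σ i ^ 2) := by
    intro i j hij
    apply Real.sqrt_le_sqrt
    have := pow_le_pow_left₀ (hσ0 j) (hσa hij) 2
    linarith
  have hsec := aux_second (by omega) (by omega) (by omega) (by omega) a b hba
    (fun i => (a + b - √((a - b) ^ 2 + 4 * σ i ^ 2)) / 2)
    (fun i => (a + b + √((a - b) ^ 2 + 4 * σ i ^ 2)) / 2)
    (fun i j hij => by have := hmono i j hij; dsimp only; linarith)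
    (fun i => by have := neg_abs_le (a - b); have := habs i; linarith)
    (fun i => by have := le_abs_self (a - b); have := habs i; linarith)
    (fun i => by have := neg_abs_le (a - b); have := habs i; linarith)
    lam hlama (by
      rw [hch, ← Finset.prod_mul_distrib]
      congr 1
      refine Finset.prod_congr rfl fun i _ => ?_
      have h1 : ∀ f g : ℝ, (X - C f) * (X - C g) = X ^ 2 - C (f + g) * X + C (f * g) := by
        intro f g
        simp only [C_add, C_mul]; ring
      rw [sub_comp, X_comp, C_comp, h1, h1, add_sub_assoc, ← C_sub]
      congr 2
      · congr 2; ring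
      · congr 1; linear_combination (1 / 4 : ℝ) * hsq i)
  have h01 : σ₂ ^ 2 ≤ σ₁ ^ 2 := pow_le_pow_left₀ (hσ0 _) (hσa (Fin.mk_le_mk.2 (by omega))) 2
  have hq := hsq ⟨1, by omega⟩
  have hnn := Real.sqrt_nonneg ((a - b) ^ 2 + 4 * σ ⟨1, by omega⟩ ^ 2)
  rw [hsec]
  change √((a - b) ^ 2 + 4 * σ₂ ^ 2) ^ 2 = (a - b) ^ 2 + 4 * σ₂ ^ 2 at hq
  change 0 ≤ √((a - b) ^ 2 + 4 * σ₂ ^ 2) at hnn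
  change (σ₁ ^ 2 - σ₂ ^ 2) / lam1 ≤ (a + b - √((a - b) ^ 2 + 4 * σ₂ ^ 2)) / 2 ∧
    (a + b - √((a - b) ^ 2 + 4 * σ₂ ^ 2)) / 2 ≤ 2 * (σ₁ ^ 2 - σ₂ ^ 2) / lam1
  generalize √((a - b) ^ 2 + 4 * σ₂ ^ 2) = r at *
  have hl0 : 0 < lam1 := by linarith
  have hr : r ≤ lam1 := by
    refine abs_le_of_sq_le_sq' ?_ hl0.le |>.2
    rw [hq, hl]; nlinarith
  have hs : σ₁ ^ 2 - σ₂ ^ 2 = (lam1 - r) * (lam1 + r) / 4 := by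
    rw [hs1, hl]; linear_combination (1 / 4 : ℝ) * hq
  rw [hs, ← hl]
  constructor
  · rw [div_le_iff₀ hl0]; nlinarith
  · rw [le_div_iff₀ hl0]; nlinarith
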